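/- arXiv:1510.03504 — 2 statements merged into one kernel-verified Lean document; each statement's English description precedes it below -/
import Mathlib

section
/- Let σ and σ' be Borel probability measures on ℝ and let (t_n) be a sequence of real numbers. If the translates t_{n*}σ (the pushforwards of σ under the maps x ↦ x + t_n) converge to σ' in the topology of weak convergence of probability measures, then the sequence (t_n) is bounded. -/
open MeasureTheory Filter Topology

/-- If the translates `t_n · σ` (pushforwards of the Borel probability
measure `σ` on `ℝ` under `x ↦ x + t n`) converge, in the topology of weak convergence of
probability measures, to a probability measure `σ'`, then the sequence `t n` is bounded. -/
theorem translates_converge_implies_bounded (σ σ' : ProbabilityMeasure ℝ) (t : ℕ → ℝ)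
    (h : Tendsto (fun n => σ.map (f := fun x => x + t n)
        (measurable_add_const (t n)).aemeasurable) atTop (𝓝 σ')) :
    ∃ M : ℝ, ∀ n, |t n| ≤ M := by
  have hcomp := h.isCompact_insert_range.insert σ
  have htight := isTightMeasureSet_of_isCompact_closure (hcomp.isClosed.closure_eq.symm ▸ hcomp)
  obtain ⟨K, hK, hle⟩ :=
    isTightMeasureSet_iff_exists_isCompact_measure_compl_le.1 htight (1 / 4) (by norm_num)
  obtain ⟨r, hr⟩ := hK.isBounded.exists_norm_le
  refine ⟨2 * r, fun n => ?_⟩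
  have hσ : (σ : Measure ℝ) Kᶜ ≤ 1 / 4 := hle _ ⟨σ, by simp, rfl⟩
  have htr : (σ : Measure ℝ) ((fun x => x + t n) ⁻¹' Kᶜ) ≤ 1 / 4 := by
    rw [← Measure.map_apply (measurable_add_const (t n)) hK.measurableSet.compl]
    exact hle _ ⟨_, Or.inr (Or.inr ⟨n, rfl⟩), rfl⟩
  by_contra! hn
  have hcover : Kᶜ ∪ (fun x => x + t n) ⁻¹' Kᶜ = Set.univ := by
    refine Set.eq_univ_of_forall fun x => ?_
    by_contra hx
    simp only [Set.mem_union, Set.mem_compl_iff, Set.mem_preimage, not_or, not_not] at hx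
    have h₁ := hr _ hx.1
    have h₂ := hr _ hx.2
    have h₃ := norm_sub_le (x + t n) x
    rw [add_sub_cancel_left, Real.norm_eq_abs (t n)] at h₃
    linarith
  have hlt : (1 : ENNReal) ≤ 1 / 4 + 1 / 4 :=
    calc (1 : ENNReal) = (σ : Measure ℝ) (Kᶜ ∪ (fun x => x + t n) ⁻¹' Kᶜ) := by
          rw [hcover, measure_univ]
      _ ≤ 1 / 4 + 1 / 4 := (measure_union_le _ _).trans (add_le_add hσ htr)
  have := ENNReal.toReal_mono (by finiteness) hlt
  rw [ENNReal.toReal_add (by finiteness) (by finiteness)] at this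
  norm_num at this
end

section
/- Let α and β be standard Borel spaces, let μ be a finite Borel measure on α × β, and let f : β → β be a measurable map such that the pushforward of μ under the map (a,b) ↦ (a, f(b)) equals μ. Let a ↦ μ_a denote the disintegration (conditional kernel) of μ with respect to the projection π : α × β → α, so that μ(E) = ∫_α μ_a({b : (a,b) ∈ E}) d(π_*μ)(a) for every measurable E ⊆ α × β. Then for π_*μ-almost every a ∈ α, the pushforward of the measure μ_a under f equals μ_a. -/
open MeasureTheory ProbabilityTheory

/-- Let `α`, `β` be standard Borel spaces, `μ` a finite Borel measure on
`α × β`, and `f : β → β` a measurable map such that `(a,b) ↦ (a, f b)` preserves `μ`.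
If `a ↦ κ a` is a disintegration of `μ` with respect to the first-coordinate projection
`π`, i.e. `μ E = ∫ₐ κ a {b | (a,b) ∈ E} d(π_*μ)(a)` for all measurable `E`, then for
`π_*μ`-almost every `a`, the pushforward of `κ a` under `f` equals `κ a`. -/
theorem condKernel_map_eq_of_invariant {α β : Type*}
    [MeasurableSpace α] [StandardBorelSpace α] [MeasurableSpace β] [StandardBorelSpace β]
    (μ : Measure (α × β)) [IsFiniteMeasure μ]
    (f : β → β) (hf : Measurable f)
    (hinv : μ.map (Prod.map id f) = μ)
    (κ : Kernel α β) [IsFiniteKernel κ]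
    (hκ : ∀ E : Set (α × β), MeasurableSet E →
      μ E = ∫⁻ a, κ a {b | (a, b) ∈ E} ∂(μ.map Prod.fst)) :
    ∀ᵐ a ∂(μ.map Prod.fst), (κ a).map f = κ a := by
  change ∀ᵐ a ∂μ.fst, (κ a).map f = κ a
  have h_disint : μ = μ.fst ⊗ₘ κ := by
    ext E hE
    rw [Measure.compProd_apply hE]
    exact hκ E hE
  have h_map : μ.fst ⊗ₘ κ.map f = μ.fst ⊗ₘ κ := by
    rw [Measure.compProd_map hf, ← h_disint, hinv]
  filter_upwards [Kernel.ae_eq_of_compProd_eq h_map] with a ha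
  rwa [Kernel.map_apply κ hf] at ha
end
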